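/- Let E : B(H) → N be a conditional expectation (norm-one projection onto a von Neumann subalgebra N). Then E is an N-bimodule map: E(n₁ x n₂) = n₁ E(x) n₂ for all n₁, n₂ ∈ N and x ∈ B(H). (Tomiyama's theorem.) -/

import Mathlib

lemma tom_pyth {H : Type*} [NormedAddCommGroup H] [InnerProductSpace ℂ H] [CompleteSpace H]
    (a b : H →L[ℂ] H) (hab : star a * b = 0) : ‖a + b‖ ^ 2 ≤ ‖a‖ ^ 2 + ‖b‖ ^ 2 := by
  have hba : star b * a = 0 := by
    have := congrArg star hab
    simpa using this
  have h : star (a + b) * (a + b) = star a * a + star b * b := by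
    rw [star_add, add_mul, mul_add, mul_add, hab, hba]; simp
  have h1 := CStarRing.norm_star_mul_self (x := a + b)
  rw [h] at h1
  have h2 := norm_add_le (star a * a) (star b * b)
  rw [CStarRing.norm_star_mul_self, CStarRing.norm_star_mul_self] at h2
  nlinarith

lemma tom_proj_zero {H : Type*} [NormedAddCommGroup H] [InnerProductSpace ℂ H] [CompleteSpace H]
    (N : VonNeumannAlgebra H) (E : (H →L[ℂ] H) →ₗ[ℂ] (H →L[ℂ] H))
    (hr : ∀ x, E x ∈ N) (hp : ∀ n, n ∈ N → E n = n) (hn : ∀ x, ‖E x‖ ≤ ‖x‖)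
    (p : H →L[ℂ] H) (hpN : p ∈ N) (hps : IsStarProjection p) (x : H →L[ℂ] H) :
    p * E ((1 - p) * x) = 0 := by
  have hpp : p * p = p := hps.isIdempotentElem
  have hsa : star p = p := hps.isSelfAdjoint
  set y := p * E ((1 - p) * x) with hy
  have hyN : y ∈ N := mul_mem hpN (hr _)
  have hpy : p * y = y := by rw [hy, ← mul_assoc, hpp]
  have hpn : ‖p‖ ≤ 1 := by
    have := CStarRing.norm_star_mul_self (x := p)
    rw [hsa, hpp] at this
    by_contra hc
    push Not at hc
    nlinarith
  have key : ∀ t : ℝ, 0 ≤ t → (1 + t) ^ 2 * ‖y‖ ^ 2 ≤ ‖(1 - p) * x‖ ^ 2 + t ^ 2 * ‖y‖ ^ 2 := by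
    intro t ht
    have h0 : star ((1 - p) * x) * ((t : ℂ) • y) = 0 := by
      have : (1 - p) * y = 0 := by rw [sub_mul, hpy]; simp
      rw [star_mul, star_sub, star_one, hsa, mul_smul_comm, mul_assoc, this]; simp
    have h1 := tom_pyth _ _ h0
    have h2 : p * E ((1 - p) * x + (t : ℂ) • y) = ((1 + t : ℝ) : ℂ) • y := by
      rw [map_add, map_smul, hp y hyN, mul_add, ← hy, mul_smul_comm, hpy]
      push_cast
      rw [add_smul, one_smul]
    have h3 : ‖p * E ((1 - p) * x + (t : ℂ) • y)‖ ≤ ‖(1 - p) * x + (t : ℂ) • y‖ := by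
      refine (norm_mul_le _ _).trans ?_
      have := hn ((1 - p) * x + (t : ℂ) • y)
      nlinarith [norm_nonneg (E ((1 - p) * x + (t : ℂ) • y))]
    rw [h2, norm_smul, Complex.norm_real, Real.norm_of_nonneg (by linarith)] at h3
    rw [norm_smul, Complex.norm_real, Real.norm_of_nonneg ht] at h1
    have h4 := pow_le_pow_left₀ (by positivity) h3 2
    rw [mul_pow] at h4 h1
    linarith
  by_contra hne
  have hpos : 0 < ‖y‖ ^ 2 := by positivity
  have := key (‖(1 - p) * x‖ ^ 2 / ‖y‖ ^ 2) (by positivity)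
  have h5 : ‖(1 - p) * x‖ ^ 2 / ‖y‖ ^ 2 * ‖y‖ ^ 2 = ‖(1 - p) * x‖ ^ 2 := by field_simp
  nlinarith [sq_nonneg ‖(1 - p) * x‖]

lemma tom_proj {H : Type*} [NormedAddCommGroup H] [InnerProductSpace ℂ H] [CompleteSpace H]
    (N : VonNeumannAlgebra H) (E : (H →L[ℂ] H) →ₗ[ℂ] (H →L[ℂ] H))
    (hr : ∀ x, E x ∈ N) (hp : ∀ n, n ∈ N → E n = n) (hn : ∀ x, ‖E x‖ ≤ ‖x‖)
    (p : H →L[ℂ] H) (hpN : p ∈ N) (hps : IsStarProjection p) (x : H →L[ℂ] H) :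
    E (p * x) = p * E x := by
  have h1 := tom_proj_zero N E hr hp hn p hpN hps x
  have h2 := tom_proj_zero N E hr hp hn (1 - p) (sub_mem (one_mem N) hpN) hps.one_sub x
  rw [sub_sub_cancel, sub_mul, one_mul, sub_eq_zero] at h2
  rw [sub_mul, one_mul, map_sub, mul_sub, sub_eq_zero] at h1
  rw [h2, h1]

set_option maxHeartbeats 2000000 in
lemma tom_approx {H : Type*} [NormedAddCommGroup H] [InnerProductSpace ℂ H] [CompleteSpace H]
    (N : VonNeumannAlgebra H) (h : H →L[ℂ] H) (hN : h ∈ N) (hsa : IsSelfAdjoint h)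
    (r : ℝ) (hr : ‖h‖ ≤ r) :
    ∃ q : H →L[ℂ] H, q ∈ N ∧ IsStarProjection q ∧ ‖h + (r • q - (r / 2) • 1)‖ ≤ r / 2 := by
  have hr0 : 0 ≤ r := (norm_nonneg _).trans hr
  set K : Submodule ℂ H := (h⁺).ker with hK
  have hKc : IsClosed (K : Set H) := ContinuousLinearMap.isClosed_ker _
  have : CompleteSpace K := hKc.completeSpace_coe
  set q : H →L[ℂ] H := K.starProjection with hq
  have hqs : IsStarProjection q := isStarProjection_starProjection
  have hcomm : ∀ y ∈ N.commutant, Commute h⁺ y := by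
    intro y hy
    have h1 : Commute h y := VonNeumannAlgebra.mem_commutant_iff.1 hy h hN
    rw [CFC.posPart_def]
    exact h1.cfcₙ_real _
  have hinv : ∀ y ∈ N.commutant, ∀ v ∈ K, y v ∈ K := by
    intro y hy v hv
    have := congrArg (fun T : H →L[ℂ] H => T v) (hcomm y hy).eq
    simp only [mul_apply_eq_comp] at this
    have hv' : h⁺ v = 0 := hv
    show h⁺ (y v) = 0
    rw [this, hv', map_zero]
  have hqN : q ∈ N := by
    rw [VonNeumannAlgebra.IsIdempotentElem.mem_iff hqs.isIdempotentElem]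
    intro y hy
    have e1 : q.range = K := by simp [hq]
    have e2 : q.ker = Kᗮ := by simp [hq]
    rw [e1, e2]
    refine ⟨fun v hv => hinv y hy v hv, fun v hv => ?_⟩
    show y v ∈ Kᗮ
    rw [Submodule.mem_orthogonal]
    intro u hu
    rw [← ContinuousLinearMap.adjoint_inner_left]
    exact hv _ (hinv _ (star_mem hy) u hu)
  refine ⟨q, hqN, hqs, ?_⟩
  have hdec : h⁺ - h⁻ = h := CFC.posPart_sub_negPart h hsa
  have hpq : h⁺ * q = 0 := by
    ext v
    exact (Submodule.starProjection_apply_mem K v : K.starProjection v ∈ K)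
  have hqn : q * h⁻ = h⁻ := by
    ext v
    refine Submodule.starProjection_eq_self_iff.2 ?_
    show h⁺ (h⁻ v) = 0
    exact congrArg (fun T : H →L[ℂ] H => T v) (CFC.posPart_mul_negPart h)
  have hqsa : star q = q := hqs.isSelfAdjoint
  have hpsa : star h⁺ = h⁺ := (CFC.posPart_nonneg h).isSelfAdjoint
  have hnsa : star h⁻ = h⁻ := (CFC.negPart_nonneg h).isSelfAdjoint
  have hqp : q * h⁺ = 0 := by
    have := congrArg star hpq
    simpa [hqsa, hpsa] using this
  have hnq : h⁻ * q = h⁻ := by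
    have := congrArg star hqn
    simpa [hqsa, hnsa] using this
  have hqq : q * q = q := hqs.isIdempotentElem
  have hp1 : h⁺ ≤ r • (1 : H →L[ℂ] H) := by
    have h1 := IsSelfAdjoint.le_algebraMap_norm_self (a := h⁺) hpsa
    refine h1.trans ?_
    rw [← Algebra.algebraMap_eq_smul_one]
    exact algebraMap_mono _ ((CStarAlgebra.norm_posPart_le h).trans hr)
  have hn1 : h⁻ ≤ r • (1 : H →L[ℂ] H) := by
    have h1 := IsSelfAdjoint.le_algebraMap_norm_self (a := h⁻) hnsa
    refine h1.trans ?_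
    rw [← Algebra.algebraMap_eq_smul_one]
    exact algebraMap_mono _ ((CStarAlgebra.norm_negPart_le h).trans hr)
  have hp2 : h⁺ ≤ r • (1 - q) := by
    have := star_left_conjugate_le_conjugate hp1 (1 - q)
    have e1 : star (1 - q) * h⁺ * (1 - q) = h⁺ := by
      rw [star_sub, star_one, hqsa, sub_mul, hqp, mul_sub, sub_mul, sub_mul]
      simp [hpq]
    have e2 : star (1 - q) * (r • (1 : H →L[ℂ] H)) * (1 - q) = r • (1 - q) := by
      rw [mul_smul_comm, mul_one, smul_mul_assoc, star_sub, star_one, hqsa]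
      congr 1
      rw [mul_sub, sub_mul, sub_mul, hqq]
      simp
    rwa [e1, e2] at this
  have hn2 : h⁻ ≤ r • q := by
    have := star_left_conjugate_le_conjugate hn1 q
    have e1 : star q * h⁻ * q = h⁻ := by rw [hqsa, hqn, hnq]
    have e2 : star q * (r • (1 : H →L[ℂ] H)) * q = r • q := by
      rw [mul_smul_comm, mul_one, smul_mul_assoc, hqsa, hqq]
    rwa [e1, e2] at this
  have hp0 : 0 ≤ h⁺ := CFC.posPart_nonneg h
  have hn0 : 0 ≤ h⁻ := CFC.negPart_nonneg h
  set g := h + (r • q - (r / 2) • (1 : H →L[ℂ] H)) with hg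
  have hgsa : IsSelfAdjoint g := by
    have hrs : ∀ s : ℝ, IsSelfAdjoint s := fun s => .all s
    exact hsa.add (((hrs r).smul hqs.isSelfAdjoint).sub ((hrs _).smul (.one _)))
  have hup : g ≤ algebraMap ℝ _ (r / 2) := by
    rw [Algebra.algebraMap_eq_smul_one, ← sub_nonneg]
    have : (r / 2) • (1 : H →L[ℂ] H) - g = (r • (1 - q) - h⁺) + h⁻ := by
      rw [hg]; nth_rewrite 1 [← hdec]; module
    rw [this]
    exact add_nonneg (sub_nonneg.2 hp2) hn0
  have hlo : - algebraMap ℝ _ (r / 2) ≤ g := by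
    rw [Algebra.algebraMap_eq_smul_one, ← sub_nonneg]
    have : g - - ((r / 2) • (1 : H →L[ℂ] H)) = (r • q - h⁻) + h⁺ := by
      rw [hg]; nth_rewrite 1 [← hdec]; module
    rw [this]
    exact add_nonneg (sub_nonneg.2 hn2) hp0
  rw [← cfc_id ℝ g]
  refine norm_cfc_le (by positivity) fun x hx => ?_
  rw [id, Real.norm_eq_abs, abs_le]
  rw [← map_neg] at hlo
  exact ⟨(algebraMap_le_iff_le_spectrum (R := ℝ) hgsa).1 hlo x hx,
    (le_algebraMap_iff_spectrum_le (R := ℝ) hgsa).1 hup x hx⟩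

lemma tom_sa {H : Type*} [NormedAddCommGroup H] [InnerProductSpace ℂ H] [CompleteSpace H]
    (N : VonNeumannAlgebra H) (E : (H →L[ℂ] H) →ₗ[ℂ] (H →L[ℂ] H))
    (hr : ∀ x, E x ∈ N) (hp : ∀ n, n ∈ N → E n = n) (hn : ∀ x, ‖E x‖ ≤ ‖x‖)
    (x : H →L[ℂ] H) (k : ℕ) : ∀ (h : H →L[ℂ] H), h ∈ N → IsSelfAdjoint h → ∀ r : ℝ, ‖h‖ ≤ r →
    ‖E (h * x) - h * E x‖ ≤ (2 * r * ‖x‖) / 2 ^ k := by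
  induction k with
  | zero =>
    intro h hN hsa r hr'
    have h1 : ‖E (h * x)‖ ≤ r * ‖x‖ :=
      (hn _).trans ((norm_mul_le _ _).trans (by gcongr))
    have h2 : ‖h * E x‖ ≤ r * ‖x‖ := (norm_mul_le _ _).trans
      (mul_le_mul hr' (hn x) (norm_nonneg _) ((norm_nonneg _).trans hr'))
    have := norm_sub_le (E (h * x)) (h * E x)
    simp only [pow_zero, div_one]
    linarith
  | succ k ih =>
    intro h hN hsa r hr'
    obtain ⟨q, hqN, hqs, hq⟩ := tom_approx N h hN hsa r hr'
    have hrs : ∀ s : ℝ, IsSelfAdjoint s := fun s => .all s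
    have hsm : ∀ (s : ℝ) (a : H →L[ℂ] H), a ∈ N → s • a ∈ N := by
      intro s a ha
      have : (s : ℂ) • a ∈ N.toStarSubalgebra := SMulMemClass.smul_mem _ ha
      exact this
    have := ih _ (add_mem hN (sub_mem (hsm r q hqN) (hsm (r / 2) 1 (one_mem N))))
      (hsa.add (((hrs r).smul hqs.isSelfAdjoint).sub ((hrs _).smul (.one _)))) _ hq
    have hproj := tom_proj N E hr hp hn q hqN hqs x
    have hsmE : ∀ (s : ℝ) (a : H →L[ℂ] H), E (s • a) = s • E a :=
      fun s a => E.map_smul_of_tower s a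
    have e : E ((h + (r • q - (r / 2) • (1 : H →L[ℂ] H))) * x)
        - (h + (r • q - (r / 2) • (1 : H →L[ℂ] H))) * E x = E (h * x) - h * E x := by
      simp only [add_mul, sub_mul, smul_mul_assoc, one_mul, map_add, map_sub, hsmE, hproj]
      abel
    rw [e] at this
    refine this.trans (le_of_eq ?_)
    rw [pow_succ]; field_simp

lemma tom_left {H : Type*} [NormedAddCommGroup H] [InnerProductSpace ℂ H] [CompleteSpace H]
    (N : VonNeumannAlgebra H) (E : (H →L[ℂ] H) →ₗ[ℂ] (H →L[ℂ] H))
    (hr : ∀ x, E x ∈ N) (hp : ∀ n, n ∈ N → E n = n) (hn : ∀ x, ‖E x‖ ≤ ‖x‖)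
    (n x : H →L[ℂ] H) (hN : n ∈ N) : E (n * x) = n * E x := by
  have hsa : ∀ h : H →L[ℂ] H, h ∈ N → IsSelfAdjoint h → E (h * x) = h * E x := by
    intro h hh hs
    have hb := fun k => tom_sa N E hr hp hn x k h hh hs ‖h‖ le_rfl
    have hlim : Filter.Tendsto (fun k : ℕ => (2 * ‖h‖ * ‖x‖) / 2 ^ k) Filter.atTop (nhds 0) :=
      Filter.Tendsto.const_div_atTop (tendsto_pow_atTop_atTop_of_one_lt (by norm_num)) _
    have := ge_of_tendsto' hlim hb
    exact sub_eq_zero.1 (norm_le_zero_iff.1 this)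
  have hsm : ∀ (s : ℂ) (a : H →L[ℂ] H), a ∈ N → s • a ∈ N := by
    intro s a ha
    have : s • a ∈ N.toStarSubalgebra := SMulMemClass.smul_mem _ ha
    exact this
  have h1 := hsa (n + star n) (add_mem hN (star_mem hN)) (IsSelfAdjoint.add_star_self n)
  have h2 := hsa (Complex.I • (n - star n)) (hsm _ _ (sub_mem hN (star_mem hN))) (by
    rw [IsSelfAdjoint, star_smul, star_sub, star_star, Complex.star_def, Complex.conj_I]
    module)
  rw [smul_mul_assoc, smul_mul_assoc, map_smul] at h2
  have h3 := smul_right_injective _ Complex.I_ne_zero h2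
  simp only [add_mul, sub_mul, map_add, map_sub] at h1 h3
  have h4 : (2 : ℂ) • E (n * x) = (2 : ℂ) • (n * E x) := by
    rw [two_smul, two_smul]
    calc _ = (E (n * x) + E (star n * x)) + (E (n * x) - E (star n * x)) := by abel
      _ = _ := by rw [h1, h3]; abel
  exact smul_right_injective _ two_ne_zero h4

/- STATEMENT 12 (Tomiyama's theorem): Let `E : B(H) → N` be a conditional
expectation, i.e. a norm-one linear projection onto a von Neumann subalgebra
`N ⊆ B(H)` (containing the identity). Then `E` is an `N`-bimodule map:
`E (n₁ x n₂) = n₁ (E x) n₂` for all `n₁, n₂ ∈ N`, `x ∈ B(H)`. -/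
theorem tomiyama_bimodule
    {H : Type*}
    [NormedAddCommGroup H] [InnerProductSpace ℂ H] [CompleteSpace H]
    (N : VonNeumannAlgebra H)
    (E : (H →L[ℂ] H) →L[ℂ] (H →L[ℂ] H))
    -- `E` maps into `N` and fixes `N` (a projection onto `N`)
    (hE_range : ∀ x : H →L[ℂ] H, E x ∈ N)
    (hE_proj : ∀ n : H →L[ℂ] H, n ∈ N → E n = n)
    -- `E` has norm one
    (hE_norm : ‖E‖ = 1) :
    ∀ (n₁ n₂ x : H →L[ℂ] H), n₁ ∈ N → n₂ ∈ N →
      E (n₁ * x * n₂) = n₁ * E x * n₂ := by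
  have hn : ∀ x, ‖E x‖ ≤ ‖x‖ := by
    intro x
    have := E.le_opNorm x
    rwa [hE_norm, one_mul] at this
  let F : (H →L[ℂ] H) →ₗ[ℂ] (H →L[ℂ] H) :=
    { toFun := fun x => star (E (star x))
      map_add' := fun x y => by simp
      map_smul' := fun c x => by simp [star_smul] }
  have hF : ∀ x, F x = star (E (star x)) := fun _ => rfl
  intro n₁ n₂ x h₁ h₂
  have hright : ∀ y, E (y * n₂) = E y * n₂ := by
    intro y
    have h := tom_left N F (fun x => star_mem (hE_range _))
      (fun n hN => by rw [hF, hE_proj _ (star_mem hN), star_star])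
      (fun x => by rw [hF, norm_star]; simpa using hn (star x))
      (star n₂) (star y) (star_mem h₂)
    have h' := congrArg star h
    simpa [hF] using h'
  rw [hright]
  congr 1
  exact tom_left N E.toLinearMap hE_range hE_proj hn n₁ x h₁
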